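/- arXiv:1612.07679 — 2 statements merged into one kernel-verified Lean document; each statement's English description precedes it below -/
import Mathlib

section
/- Let Λ be an artin algebra and M an indecomposable module generated by modules of length 2 (a bristled module). If |top M| denotes the length of M/rad M and |soc M| the length of the socle of M, then |top M| ≥ |soc M|, with equality if and only if M is simple or M is a bristle (an indecomposable module of length 2). -/
open Order

variable (R M : Type*) [Ring R] [AddCommGroup M] [Module R M]

/-- The (composition) length of a module: the length of a longest chain of
submodules. -/
noncomputable def moduleLength : WithBot ℕ∞ := Order.krullDim (Submodule R M)

/-- The radical of a module: the intersection of all maximal submodules. -/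
def moduleRadical : Submodule R M := sInf {m : Submodule R M | IsCoatom m}

/-- The socle of a module: the sum of all simple (= atomic) submodules. -/
def moduleSocle : Submodule R M := sSup {S : Submodule R M | IsAtom S}

/-- A module is bristled if it is generated by modules of length 2;
equivalently, it is the sum of its submodules of length at most 2. -/
def IsBristled : Prop :=
  sSup {N : Submodule R M | moduleLength R N ≤ 2} = ⊤

/-- An indecomposable module: nonzero, with no nontrivial direct decomposition. -/
def ModIndec : Prop :=
  Nontrivial M ∧ ∀ N N' : Submodule R M, IsCompl N N' → N = ⊥ ∨ N' = ⊥

namespace BrAux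

variable {R M : Type*} [Ring R] [AddCommGroup M] [Module R M]

theorem ml_eq (R M : Type*) [Ring R] [AddCommGroup M] [Module R M] :
    moduleLength R M = (Module.length R M : WithBot ℕ∞) := (Module.coe_length R M).symm

theorem length_comap {P Q : Submodule R M} (h : P ≤ Q) :
    Module.length R (Submodule.comap Q.subtype P) = Module.length R P :=
  (Submodule.comapSubtypeEquivOfLe h).length_eq

theorem length_quot (P : Submodule R M) :
    Module.length R M = Module.length R P + Module.length R (M ⧸ P) :=
  Module.length_eq_add_of_exact P.subtype P.mkQ P.subtype_injective P.mkQ_surjective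
    (LinearMap.exact_subtype_mkQ P)

theorem length_mod (P Q : Submodule R M) :
    Module.length R ↥(P ⊔ Q) + Module.length R ↥(P ⊓ Q)
      = Module.length R P + Module.length R Q := by
  have h1 := length_quot (Submodule.comap P.subtype (P ⊓ Q))
  have h2 := length_quot (Submodule.comap (P ⊔ Q).subtype Q)
  have h3 := (LinearMap.quotientInfEquivSupQuotient P Q).length_eq
  rw [length_comap inf_le_left, Submodule.comap_inf] at h1
  rw [length_comap le_sup_right, ← h3] at h2
  rw [h1, h2]
  ring

/-- natural-number length of a submodule -/
noncomputable def ell (P : Submodule R M) : ℕ := (Module.length R P).toNat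

variable [IsArtinian R M] [IsNoetherian R M]

theorem coe_ell (P : Submodule R M) : ((ell P : ℕ) : ℕ∞) = Module.length R P :=
  ENat.natCast_toNat Module.length_ne_top

theorem ell_mod (P Q : Submodule R M) : ell (P ⊔ Q) + ell (P ⊓ Q) = ell P + ell Q := by
  have := length_mod P Q
  simp only [← coe_ell] at this
  exact_mod_cast this

theorem ell_pos {P : Submodule R M} : 0 < ell P ↔ P ≠ ⊥ := by
  rw [← Submodule.nontrivial_iff_ne_bot, ← Module.length_pos_iff (R := R), ← coe_ell]
  exact_mod_cast Iff.rfl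

theorem ell_strict {P Q : Submodule R M} (h : P < Q) : ell P < ell Q := by
  have := Submodule.height_strictMono h
  rw [← Module.length_submodule, ← Module.length_submodule, ← coe_ell, ← coe_ell] at this
  exact_mod_cast this

theorem ell_mono {P Q : Submodule R M} (h : P ≤ Q) : ell P ≤ ell Q := by
  rcases h.eq_or_lt with rfl | h
  · exact le_rfl
  · exact (ell_strict h).le

theorem socle_inf {B : Submodule R M} (h : B ≠ ⊥) : B ⊓ moduleSocle R M ≠ ⊥ := by
  obtain ⟨a, ha, hab⟩ := (eq_bot_or_exists_atom_le B).resolve_left h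
  intro h0
  have : a ≤ B ⊓ moduleSocle R M := le_inf hab (le_sSup ha)
  rw [h0] at this
  exact ha.1 (le_bot_iff.mp this)

theorem step (hbr : IsBristled R M) {S : Submodule R M} (hS : moduleSocle R M ≤ S)
    (N : Submodule R M) (hN : N ⊔ S ≠ ⊤) :
    ∃ B : Submodule R M, ell B ≤ 2 ∧ ell (N ⊔ B ⊔ S) = ell (N ⊔ S) + 1 := by
  have : ∃ B : Submodule R M, moduleLength R B ≤ 2 ∧ ¬ B ≤ N ⊔ S := by
    by_contra! hc
    apply hN
    rw [eq_top_iff, ← hbr]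
    exact sSup_le hc
  obtain ⟨B, hB, hBN⟩ := this
  have hB2 : ell B ≤ 2 := by
    rw [ml_eq, ← coe_ell] at hB
    have hB' : ((ell B : ℕ) : ℕ∞) ≤ ((2 : ℕ) : ℕ∞) := WithBot.coe_le_coe.mp hB
    exact Nat.cast_le.mp hB'
  refine ⟨B, hB2, ?_⟩
  have hb : B ≠ ⊥ := by rintro rfl; exact hBN bot_le
  have h1 : N ⊔ B ⊔ S = (N ⊔ S) ⊔ B := by ac_rfl
  rw [h1]
  have h2 : 0 < ell ((N ⊔ S) ⊓ B) := by
    rw [ell_pos]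
    intro h0
    apply socle_inf hb
    rw [← le_bot_iff, ← h0]
    exact le_inf (inf_le_right.trans (hS.trans le_sup_right)) inf_le_left
  have h3 := ell_mod (N ⊔ S) B
  have h4 : ell (N ⊔ S) < ell ((N ⊔ S) ⊔ B) := ell_strict (left_lt_sup.mpr hBN)
  omega

theorem build (hbr : IsBristled R M) {S : Submodule R M} (hS : moduleSocle R M ≤ S)
    (k : ℕ) (hk : k + ell S ≤ ell (⊤ : Submodule R M)) :
    ∃ N : Submodule R M, ell N ≤ 2 * k ∧ ell (N ⊔ S) = k + ell S := by
  induction k with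
  | zero =>
    refine ⟨⊥, ?_, by simp⟩
    have := (ell_pos (P := (⊥ : Submodule R M))).not.mpr (by simp)
    omega
  | succ k ih =>
    obtain ⟨N, h1, h2⟩ := ih (by omega)
    obtain ⟨B, h3, h4⟩ := step hbr hS N (by intro h; rw [h] at h2; omega)
    refine ⟨N ⊔ B, ?_, by omega⟩
    have := ell_mod N B
    omega

theorem sup_rad {N : Submodule R M} (h : N ⊔ moduleRadical R M = ⊤) : N = ⊤ := by
  by_contra hN
  obtain ⟨m, hm, hNm⟩ := (eq_top_or_exists_le_coatom N).resolve_left hN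
  apply hm.1
  rw [eq_top_iff, ← h]
  exact sup_le hNm (sInf_le hm)

theorem soc_le_rad (hind : ModIndec R M) (hs : ¬ IsSimpleModule R M) :
    moduleSocle R M ≤ moduleRadical R M := by
  refine sSup_le fun a ha => le_sInf fun m hm => ?_
  have ha : IsAtom a := ha
  have hm : IsCoatom m := hm
  by_contra hc
  have hd : Disjoint a m := (ha.not_le_iff_disjoint).mp hc
  have hcd : Codisjoint a m := by
    rw [codisjoint_iff]
    exact hm.2 _ (right_lt_sup.mpr hc)
  rcases hind.2 a m ⟨hd, hcd⟩ with h | h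
  · exact ha.1 h
  · subst h
    apply hs
    have : a = ⊤ := by simpa using hcd
    subst this
    rw [isSimpleModule_iff]
    have := hind.1
    exact isSimpleOrder_iff_isAtom_top.mpr ha

end BrAux

/-- For an indecomposable bristled module `M` over an artin algebra,
`|top M| ≥ |soc M|`, with equality if and only if `M` is simple or a bristle
(an indecomposable module of length 2). -/
theorem top_length_ge_socle_length (R M : Type*) [Ring R] [IsArtinianRing R]
    [AddCommGroup M] [Module R M] [Module.Finite R M]
    (hind : ModIndec R M) (hbr : IsBristled R M) :
    moduleLength R (moduleSocle R M) ≤ moduleLength R (M ⧸ moduleRadical R M) ∧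
      (moduleLength R (moduleSocle R M) = moduleLength R (M ⧸ moduleRadical R M) ↔
        IsSimpleModule R M ∨ (ModIndec R M ∧ moduleLength R M = 2)) := by
  have hne := hind.1
  have hN : IsNoetherian R M := inferInstance
  have hA : IsArtinian R M := inferInstance
  by_cases hs : IsSimpleModule R M
  · have htop : moduleSocle R M = ⊤ := by
      refine top_le_iff.mp (le_sSup ?_)
      exact isSimpleOrder_iff_isAtom_top.mp ((isSimpleModule_iff R M).mp hs)
    have hbot : moduleRadical R M = ⊥ := by
      refine le_bot_iff.mp (sInf_le ?_)
      exact isSimpleOrder_iff_isCoatom_bot.mp ((isSimpleModule_iff R M).mp hs)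
    have heq : moduleLength R (moduleSocle R M) = moduleLength R (M ⧸ moduleRadical R M) := by
      rw [htop, hbot, BrAux.ml_eq, BrAux.ml_eq, Module.length_top,
        (Submodule.quotEquivOfEqBot (⊥ : Submodule R M) rfl).length_eq]
    exact ⟨heq.le, fun _ => Or.inl hs, fun _ => heq⟩
  have hle := BrAux.soc_le_rad hind hs
  obtain ⟨t, ht⟩ := ENat.ne_top_iff_exists.mp
    (Module.length_ne_top (R := R) (M := M ⧸ moduleRadical R M))
  have htot : BrAux.ell (⊤ : Submodule R M) = BrAux.ell (moduleRadical R M) + t := by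
    have := BrAux.length_quot (moduleRadical R M)
    rw [← Module.length_top, ← BrAux.coe_ell, ← BrAux.coe_ell, ← ht] at this
    exact_mod_cast this
  have hsr := BrAux.ell_mono hle
  have hspos : 0 < BrAux.ell (moduleSocle R M) := by
    rw [BrAux.ell_pos]
    intro h
    apply BrAux.socle_inf (R := R) (M := M) (B := ⊤) top_ne_bot
    rw [h, inf_bot_eq]
  have htpos : 0 < t := by
    have : 0 < Module.length R (M ⧸ moduleRadical R M) := by
      rw [Module.length_pos_iff, Submodule.Quotient.nontrivial_iff]
      exact (Module.jacobson_lt_top R M).ne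
    rw [← ht] at this
    exact_mod_cast this
  obtain ⟨N, hN1, hN2⟩ := BrAux.build hbr hle (t - 1) (by omega)
  obtain ⟨B, hB1, hB2⟩ := BrAux.step hbr hle N (by intro h; rw [h] at hN2; omega)
  have hNB : N ⊔ B = ⊤ := by
    apply BrAux.sup_rad
    by_contra hc
    have := BrAux.ell_strict (lt_top_iff_ne_top.mpr hc)
    omega
  have hmod := BrAux.ell_mod N B
  rw [hNB] at hmod
  have hle' : BrAux.ell (moduleSocle R M) ≤ t := by omega
  rw [BrAux.ml_eq, BrAux.ml_eq, BrAux.ml_eq, ← ht, ← BrAux.coe_ell, ← Module.length_top,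
    ← BrAux.coe_ell]
  refine ⟨by exact_mod_cast hle', ?_⟩
  have e1 : (((BrAux.ell (moduleSocle R M) : ℕ) : ℕ∞) : WithBot ℕ∞) = ((t : ℕ∞) : WithBot ℕ∞) ↔
      BrAux.ell (moduleSocle R M) = t := by norm_cast
  have e2 : (((BrAux.ell (⊤ : Submodule R M) : ℕ) : ℕ∞) : WithBot ℕ∞) = 2 ↔
      BrAux.ell (⊤ : Submodule R M) = 2 :=
    (WithBot.coe_inj (a := ((BrAux.ell (⊤ : Submodule R M) : ℕ) : ℕ∞))
      (b := ((2 : ℕ) : ℕ∞))).trans Nat.cast_inj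
  rw [e1, e2]
  constructor
  · intro h
    refine Or.inr ⟨hind, ?_⟩
    have hinf : N ⊓ B = ⊥ := by
      by_contra hc
      have := BrAux.ell_pos.mpr hc
      omega
    rcases hind.2 N B ⟨disjoint_iff.mpr hinf, codisjoint_iff.mpr hNB⟩ with h0 | h0
    · have := BrAux.ell_pos.not.mpr (not_not.mpr h0)
      omega
    · have := BrAux.ell_pos.not.mpr (not_not.mpr h0)
      omega
  · rintro (h | ⟨-, h⟩)
    · exact absurd h hs
    · omega
end

section
/- Let k be a field, n ≥ 2, and let B be a bristle of the n-Kronecker quiver. If M is a module admitting an epimorphism M → B, then M is not B-saturated; i.e., Ext¹(B, M) ≠ 0. -/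
open Function

/-- Let `n ≥ 2` and let `B = B(λ)` be a bristle of the `n`-Kronecker quiver.
If the `n`-Kronecker module `M = (M₁,M₂;α)` admits an epimorphism `M → B`,
then `M` is not `B`-saturated: `Ext¹(B, M) ≠ 0`.  Here `Ext¹(B, M)` is the
cokernel of the standard map `M₁ × M₂ → (Fin n → M₂)`,
`(u,w) ↦ (αᵢ u − λᵢ w)ᵢ`, coming from the projective resolution of `B`. -/
theorem ext_bristle_ne_zero_of_epi (k : Type*) [Field k] (n : ℕ) (hn : 2 ≤ n)
    (M1 M2 : Type*) [AddCommGroup M1] [Module k M1] [AddCommGroup M2] [Module k M2]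
    [FiniteDimensional k M1] [FiniteDimensional k M2]
    (α : Fin n → M1 →ₗ[k] M2)
    (lam : Fin n → k) (hlam : lam ≠ 0)
    (g1 : M1 →ₗ[k] k) (g2 : M2 →ₗ[k] k)
    (hsur1 : Surjective g1) (hsur2 : Surjective g2)
    (hcomm : ∀ i x, g2 (α i x) = lam i * g1 x) :
    LinearMap.range
      (LinearMap.pi fun i : Fin n =>
        (α i).comp (LinearMap.fst k M1 M2) - lam i • LinearMap.snd k M1 M2) ≠
      (⊤ : Submodule k (Fin n → M2)) := by
  intro htop
  obtain ⟨j, hj⟩ := Function.ne_iff.mp hlam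
  have : Nontrivial (Fin n) := Fin.nontrivial_iff_two_le.mpr hn
  obtain ⟨i, hij⟩ := exists_ne j
  obtain ⟨m, hm⟩ := hsur2 1
  have hmem : (Pi.single i m : Fin n → M2) ∈ (⊤ : Submodule k (Fin n → M2)) := trivial
  rw [← htop] at hmem
  obtain ⟨⟨u, w⟩, huw⟩ := hmem
  have key : ∀ l, lam l * (g1 u - g2 w) = g2 ((Pi.single i m : Fin n → M2) l) := by
    intro l
    rw [← huw]
    simp [hcomm, mul_sub]
  have h1 := key j
  rw [Pi.single_eq_of_ne hij.symm, map_zero] at h1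
  have h2 := key i
  rw [Pi.single_eq_same, hm, (mul_eq_zero.mp h1).resolve_left hj, mul_zero] at h2
  exact zero_ne_one h2
end
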